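/- arXiv:1706.08804 — 2 statements merged into one kernel-verified Lean document; each statement's English description precedes it below -/
import Mathlib

section
/- Let M = (M_p) be a logarithmically convex sequence of positive reals with M_0 = 1, whose quotients m_p := M_{p+1}/M_p tend to infinity, and which admits a nonzero proximate order, and let γ > 0 be arbitrary. Suppose f is a bounded holomorphic function on the sector S_γ that admits a continuous extension to the boundary ∂S_γ and is M-flat in the direction d = πγ/2. Then for every 0 < δ < πγ there exist constants k1(δ), k2(δ) > 0 such that |f(z)| ≤ k1·e^{−M(1/(k2·|z|))} for every z with arg(z) ∈ [−πγ/2 + δ, πγ/2]. -/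
open Filter Topology Set
open scoped Real

noncomputable section

/-!
We model functions on (subsets of) the Riemann surface of the logarithm through the
logarithmic chart: a point `z = e^w` of the Riemann surface (with modulus `|z| = exp (Re w)`
and argument `arg z = Im w`) corresponds to the point `w : ℂ`.  A holomorphic function `f`
on a sector corresponds to the holomorphic function `w ↦ f (e^w)` on the corresponding
horizontal strip, and `z → 0` corresponds to `Re w → -∞`.
-/

/-- `M` is a sequence of positive reals with `M 0 = 1`, logarithmically convex,
whose sequence of quotients `m p = M (p+1) / M p` tends to infinity. -/
def GoodSeq (M : ℕ → ℝ) : Prop :=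
  M 0 = 1 ∧ (∀ p, 0 < M p) ∧ (∀ p : ℕ, (M (p + 1)) ^ 2 ≤ M p * M (p + 2)) ∧
    Tendsto (fun p : ℕ => M (p + 1) / M p) atTop atTop

/-- The associated function `M(t) = sup_p log (t^p / M_p)`. -/
def assocM (M : ℕ → ℝ) (t : ℝ) : ℝ := ⨆ p : ℕ, Real.log (t ^ p / M p)

/-- The index `ω(M) = liminf_p log (m_p) / log p`. -/
def omegaM (M : ℕ → ℝ) : ℝ :=
  Filter.liminf (fun p : ℕ => Real.log (M (p + 1) / M p) / Real.log (p : ℝ)) atTop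

/-- `ρ` is a proximate order on `(c, ∞)` with limit `ℓ` at infinity:  continuous and
piecewise continuously differentiable (differentiable except possibly on a set `E` of points
that is finite below any bound, at each of which it has distinct finite lateral derivatives),
nonnegative, with `ρ(r) → ℓ` and `r ρ'(r) log r → 0` as `r → ∞`. -/
def IsProximateOrder (c : ℝ) (ρ : ℝ → ℝ) (ℓ : ℝ) : Prop :=
  ContinuousOn ρ (Ioi c) ∧ (∀ r ∈ Ioi c, 0 ≤ ρ r) ∧ Tendsto ρ atTop (𝓝 ℓ) ∧
    ∃ (E : Set ℝ) (ρ' : ℝ → ℝ),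
      (∀ R : ℝ, (E ∩ Iic R).Finite) ∧
      (∀ r ∈ Ioi c \ E, HasDerivAt ρ (ρ' r) r) ∧
      ContinuousOn ρ' (Ioi c \ E) ∧
      (∀ r ∈ E ∩ Ioi c, ∃ dl dr : ℝ, dl ≠ dr ∧
        HasDerivWithinAt ρ dl (Iio r) r ∧ HasDerivWithinAt ρ dr (Ioi r) r) ∧
      Tendsto (fun r => r * ρ' r * Real.log r) (atTop ⊓ 𝓟 (Ioi c \ E)) (𝓝 0)

/-- The sequence `M` admits a nonzero proximate order: there are a nonzero proximate order
`ρ(t)` and constants `A ≤ B` with `A ≤ log t · (ρ(t) − d_M(t)) ≤ B` for `t` large,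
where `d_M(t) = log M(t) / log t`. -/
def AdmitsNonzeroProximateOrder (M : ℕ → ℝ) : Prop :=
  ∃ (c ℓ : ℝ) (ρ : ℝ → ℝ), 0 < ℓ ∧ IsProximateOrder c ρ ℓ ∧
    ∃ A B : ℝ, ∀ᶠ t in atTop,
      A ≤ Real.log t * (ρ t - Real.log (assocM M t) / Real.log t) ∧
      Real.log t * (ρ t - Real.log (assocM M t) / Real.log t) ≤ B

/-- The unbounded open sector `S(d, γ)` (bisecting direction `d`, opening `γπ`),
in the logarithmic chart. -/
def logSector (d γ : ℝ) : Set ℂ := {w : ℂ | |w.im - d| < γ * π / 2}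

/-- The bounded open sector `S(d, γ, R)` (radius `R`), in the logarithmic chart. -/
def logSectorB (d γ R : ℝ) : Set ℂ :=
  {w : ℂ | |w.im - d| < γ * π / 2 ∧ w.re < Real.log R}

/-- The closure of `S(d, γ, R)` in the Riemann surface of the logarithm
(the vertex is not present), in the logarithmic chart. -/
def logSectorC (d γ R : ℝ) : Set ℂ :=
  {w : ℂ | |w.im - d| ≤ γ * π / 2 ∧ w.re ≤ Real.log R}

/-- `G` is a sectorial region `G(d, γ)`: an open connected subset of `S(d, γ)` that,
for every `0 < β < γ`, contains a bounded sector `S(d, β, ρ)`. -/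
def SectorialRegion (d γ : ℝ) (G : Set ℂ) : Prop :=
  IsOpen G ∧ IsConnected G ∧ G ⊆ logSector d γ ∧
    ∀ β : ℝ, 0 < β → β < γ → ∃ ρ : ℝ, 0 < ρ ∧ logSectorB d β ρ ⊆ G

/-- The bounded sector `S(d, β, r)` is a proper subsector of `G` (written `T ≪ G`):
its closure in the Riemann surface of the logarithm is contained in `G`. -/
def ProperSubsector (G : Set ℂ) (d β r : ℝ) : Prop :=
  0 < β ∧ 0 < r ∧ logSectorC d β r ⊆ G

/-- `f` (defined on `D`) is `M`-flat in the direction `θ`: there are `r, C, A > 0` such that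
the segment `(0, r e^{iθ}]` lies in `D` and `|f(z)| ≤ C A^p M_p |z|^p` on it, for all `p`. -/
def MFlatDir (M : ℕ → ℝ) (f : ℂ → ℂ) (D : Set ℂ) (θ : ℝ) : Prop :=
  ∃ r C A : ℝ, 0 < r ∧ 0 < C ∧ 0 < A ∧
    (∀ x : ℝ, x ≤ Real.log r → (⟨x, θ⟩ : ℂ) ∈ D) ∧
    ∀ x : ℝ, x ≤ Real.log r → ∀ p : ℕ,
      ‖f ⟨x, θ⟩‖ ≤ C * A ^ p * M p * Real.exp x ^ p

/-- `f` (bounded, defined on `D`) is Beurling `M`-flat in the direction `θ`. -/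
def BeurlingFlatDir (M : ℕ → ℝ) (f : ℂ → ℂ) (D : Set ℂ) (θ : ℝ) : Prop :=
  ∀ c2 : ℝ, 0 < c2 → ∃ c1 : ℝ, 0 < c1 ∧
    ∀ w ∈ D, w.im = θ →
      ‖f w‖ ≤ c1 * Real.exp (-assocM M (1 / (c2 * Real.exp w.re)))

/-- `f` admits `Σ a_n z^n` as its `M`-asymptotic expansion in the region `G`:  on every
proper subsector `T ≪ G` there are `C, A > 0` with
`|f(z) − Σ_{n<p} a_n z^n| ≤ C A^p M_p |z|^p` for all `z ∈ T`, `p ∈ ℕ`.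
(In the logarithmic chart, `z = e^w`.) -/
def AsympExpandsOn (M : ℕ → ℝ) (f : ℂ → ℂ) (a : ℕ → ℂ) (G : Set ℂ) : Prop :=
  ∀ d β r : ℝ, ProperSubsector G d β r → ∃ C A : ℝ, 0 < C ∧ 0 < A ∧
    ∀ w ∈ logSectorB d β r, ∀ p : ℕ,
      ‖f w - ∑ n ∈ Finset.range p, a n * Complex.exp w ^ n‖
        ≤ C * A ^ p * M p * Real.exp w.re ^ p

/-- `f` admits `Σ a_n z^n` as its `M`-asymptotic expansion in the direction `θ`: there are
`r, C, A > 0` such that the segment `(0, r e^{iθ}]` lies in `G` and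
`|f(z) − Σ_{n<p} a_n z^n| ≤ C A^p M_p |z|^p` on it, for all `p`. -/
def AsympExpandsDir (M : ℕ → ℝ) (f : ℂ → ℂ) (a : ℕ → ℂ) (G : Set ℂ) (θ : ℝ) : Prop :=
  ∃ r C A : ℝ, 0 < r ∧ 0 < C ∧ 0 < A ∧
    (∀ x : ℝ, x ≤ Real.log r → (⟨x, θ⟩ : ℂ) ∈ G) ∧
    ∀ x : ℝ, x ≤ Real.log r → ∀ p : ℕ,
      ‖f (⟨x, θ⟩ : ℂ) - ∑ n ∈ Finset.range p, a n * Complex.exp (⟨x, θ⟩ : ℂ) ^ n‖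
        ≤ C * A ^ p * M p * Real.exp x ^ p

/-- The derivative with respect to the base variable `z = e^w`, in the logarithmic chart:
`(d/dz) f = e^{-w} (d/dw) f`. -/
def zderiv (f : ℂ → ℂ) : ℂ → ℂ := fun w => Complex.exp (-w) * deriv f w

/-- The filter of approach to the vertex (`z → 0`, i.e. `Re w → -∞`) within `D`. -/
def vertexFilter (D : Set ℂ) : Filter ℂ := Filter.comap Complex.re atBot ⊓ 𝓟 D

/-- The class `Ã^u_M(S)` contains no nontrivial function whose uniform `M`-asymptotic
expansion on `S` is the null power series. -/
def UniformQuasianalytic (M : ℕ → ℝ) (S : Set ℂ) : Prop :=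
  ∀ f : ℂ → ℂ, DifferentiableOn ℂ f S →
    (∃ C A : ℝ, 0 < C ∧ 0 < A ∧
      ∀ w ∈ S, ∀ p : ℕ, ‖f w‖ ≤ C * A ^ p * M p * Real.exp w.re ^ p) →
    ∀ w ∈ S, f w = 0

/-- Monotonicity with finitely many exceptional points. -/
theorem aux_mono (F : Finset ℝ) : ∀ (G : ℝ → ℝ) (a b : ℝ), a ≤ b → ContinuousOn G (Icc a b) →
    (∀ x ∈ Ioo a b, x ∉ F → ∃ d, 0 ≤ d ∧ HasDerivAt G d x) → G a ≤ G b := by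
  induction F using Finset.induction_on with
  | empty =>
    intro G a b hab hc hd
    have := monotoneOn_of_deriv_nonneg (convex_Icc a b) hc
      (fun x hx => by
        rw [interior_Icc] at hx
        obtain ⟨d, _, hd⟩ := hd x hx (by simp)
        exact hd.differentiableAt.differentiableWithinAt)
      (fun x hx => by
        rw [interior_Icc] at hx
        obtain ⟨d, h0, hd⟩ := hd x hx (by simp)
        rw [hd.deriv]; exact h0)
    exact this (left_mem_Icc.2 hab) (right_mem_Icc.2 hab) hab
  | insert e F he ih =>
    intro G a b hab hc hd
    by_cases hE : e ∈ Ioo a b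
    · have h1 : G a ≤ G e := ih G a e hE.1.le (hc.mono (Icc_subset_Icc_right hE.2.le))
        (fun x hx hxF => hd x ⟨hx.1, hx.2.trans hE.2⟩ (by
          simp only [Finset.mem_insert, not_or]; exact ⟨hx.2.ne, hxF⟩))
      have h2 : G e ≤ G b := ih G e b hE.2.le (hc.mono (Icc_subset_Icc_left hE.1.le))
        (fun x hx hxF => hd x ⟨hE.1.trans hx.1, hx.2⟩ (by
          simp only [Finset.mem_insert, not_or]; exact ⟨hx.1.ne', hxF⟩))
      exact h1.trans h2
    · exact ih G a b hab hc (fun x hx hxF => hd x hx (by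
          simp only [Finset.mem_insert, not_or]
          exact ⟨fun h => hE (h ▸ hx), hxF⟩))

theorem aux_bdd (M : ℕ → ℝ) (hM : GoodSeq M) (t : ℝ) (ht : 0 < t) :
    BddAbove (range fun p : ℕ => Real.log (t ^ p / M p)) := by
  obtain ⟨h0, hpos, -, htend⟩ := hM
  obtain ⟨P, hP⟩ := eventually_atTop.1 (htend.eventually_ge_atTop t)
  have hev : ∀ p, P ≤ p → Real.log (t ^ p / M p) ≤ Real.log (t ^ P / M P) := by
    intro p hp
    induction p, hp using Nat.le_induction with
    | base => exact le_rfl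
    | succ n hn ih =>
      refine le_trans (Real.log_le_log (by have := hpos (n+1); positivity) ?_) ih
      have h1 := hP n hn
      rw [le_div_iff₀ (hpos n)] at h1
      rw [div_le_div_iff₀ (hpos _) (hpos _), pow_succ]
      have : 0 ≤ t ^ n := by positivity
      nlinarith
  refine ⟨∑ p ∈ Finset.range (P+1), |Real.log (t ^ p / M p)|, ?_⟩
  rintro _ ⟨p, rfl⟩
  have key : ∀ q, q ≤ P → Real.log (t ^ q / M q) ≤
      ∑ p ∈ Finset.range (P+1), |Real.log (t ^ p / M p)| := fun q hq =>
    (le_abs_self _).trans (Finset.single_le_sum (f := fun p => |Real.log (t ^ p / M p)|)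
      (fun _ _ => abs_nonneg _) (Finset.mem_range.2 (by omega)))
  rcases le_total p P with h | h
  · exact key p h
  · exact (hev p h).trans (key P le_rfl)

theorem aux_le (M : ℕ → ℝ) (hM : GoodSeq M) (t : ℝ) (ht : 0 < t) (p : ℕ) :
    Real.log (t ^ p / M p) ≤ assocM M t := le_ciSup (aux_bdd M hM t ht) p

theorem aux_nonneg (M : ℕ → ℝ) (hM : GoodSeq M) (t : ℝ) (ht : 0 < t) : 0 ≤ assocM M t := by
  have := aux_le M hM t ht 0
  simpa [hM.1] using this

theorem aux_monoM (M : ℕ → ℝ) (hM : GoodSeq M) (s t : ℝ) (hs : 0 < s) (hst : s ≤ t) :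
    assocM M s ≤ assocM M t := by
  refine ciSup_mono (aux_bdd M hM t (hs.trans_le hst)) (fun p => ?_)
  have := hM.2.1 p
  exact Real.log_le_log (by positivity) (by gcongr)

theorem aux_absorb (M : ℕ → ℝ) (hM : GoodSeq M) (hPO : AdmitsNonzeroProximateOrder M)
    (c : ℝ) (hc : 0 < c) : ∃ lam T : ℝ, 1 ≤ lam ∧ 0 < T ∧
      ∀ t, T ≤ t → assocM M t ≤ c * assocM M (lam * t) := by
  obtain ⟨c0, l, ρ, hl, ⟨hcont, -, hlim, E, ρ', hfin, hder, -, -, htend⟩, A, B, hAB⟩ := hPO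
  have e1 : ∀ᶠ r in atTop, l * (3/4) < ρ r := hlim.eventually_const_lt (by linarith)
  have e2 : ∀ᶠ r in (atTop : Filter ℝ), r ∈ Ioi c0 \ E → -(l/4) < r * ρ' r * Real.log r :=
    eventually_inf_principal.1 (htend.eventually_const_lt (by linarith))
  obtain ⟨T, hT⟩ := eventually_atTop.1 (e1.and (e2.and (hAB.and
    ((eventually_gt_atTop c0).and ((eventually_gt_atTop 1).and (eventually_gt_atTop (M 1)))))))
  set D := max 0 (2 / l * (B - A - Real.log c)) with hD
  have hT1 : 1 < T := (hT T le_rfl).2.2.2.2.1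
  refine ⟨Real.exp D, T, Real.one_le_exp (le_max_left _ _), by linarith, fun t ht => ?_⟩
  have ht0 : 0 < t := by linarith
  have hlam : 1 ≤ Real.exp D := Real.one_le_exp (le_max_left _ _)
  have htt : t ≤ Real.exp D * t := by nlinarith
  have hmono := aux_mono (hfin (Real.exp D * t)).toFinset
    (fun r => Real.log r * ρ r - l / 2 * Real.log r) t (Real.exp D * t) htt
    (by
      have h1 : ContinuousOn Real.log (Icc t (Real.exp D * t)) :=
        Real.continuousOn_log.mono (fun x hx => (ht0.trans_le hx.1).ne')
      have h2 : ContinuousOn ρ (Icc t (Real.exp D * t)) :=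
        hcont.mono (fun x hx => (hT x (ht.trans hx.1)).2.2.2.1)
      exact (h1.mul h2).sub (continuousOn_const.mul h1))
    (by
      intro x hx hxE
      have hTx := hT x (ht.trans hx.1.le)
      have hx0 : 0 < x := ht0.trans hx.1
      have hxE' : x ∈ Ioi c0 \ E := ⟨hTx.2.2.2.1, fun h => hxE (by
        simp only [Set.Finite.mem_toFinset]; exact ⟨h, hx.2.le⟩)⟩
      have hlog := Real.hasDerivAt_log hx0.ne'
      refine ⟨_, ?_, (hlog.mul (hder x hxE')).sub (hlog.const_mul (l/2))⟩
      have h2 := hTx.2.1 hxE'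
      have h1 := hTx.1
      have : x⁻¹ * ρ x + Real.log x * ρ' x - l / 2 * x⁻¹ =
          x⁻¹ * (ρ x + x * ρ' x * Real.log x - l / 2) := by
        field_simp
      rw [this]
      have : 0 < x⁻¹ := by positivity
      exact mul_nonneg this.le (by linarith))
  have hpos : ∀ s, T ≤ s → 0 < assocM M s := by
    intro s hs
    have h1 := (hT s hs).2.2.2.2.2
    have h2 := aux_le M hM s (by linarith) 1
    have h3 := hM.2.1 1
    refine lt_of_lt_of_le (Real.log_pos ?_) h2
    rw [pow_one, one_lt_div h3]; exact h1
  have hb : ∀ s, T ≤ s → A ≤ Real.log s * ρ s - Real.log (assocM M s) ∧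
      Real.log s * ρ s - Real.log (assocM M s) ≤ B := by
    intro s hs
    have h1 := (hT s hs).2.2.1
    have h2 : Real.log s ≠ 0 := (Real.log_pos (by linarith)).ne'
    have h3 : Real.log s * (ρ s - Real.log (assocM M s) / Real.log s)
      = Real.log s * ρ s - Real.log (assocM M s) := by field_simp
    rwa [h3] at h1
  have hlogmul : Real.log (Real.exp D * t) = D + Real.log t := by
    rw [Real.log_mul (Real.exp_pos _).ne' ht0.ne', Real.log_exp]
  have b1 := hb t ht
  have b2 := hb _ (ht.trans htt)
  have hDle : B - A - Real.log c ≤ l / 2 * D := by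
    have : 2 / l * (B - A - Real.log c) ≤ D := le_max_right _ _
    calc B - A - Real.log c = l / 2 * (2 / l * (B - A - Real.log c)) := by field_simp
      _ ≤ _ := by gcongr
  simp only [hlogmul] at hmono b2
  have p1 := hpos t ht
  have p2 := hpos _ (ht.trans htt)
  rw [← Real.log_le_log_iff p1 (mul_pos hc p2), Real.log_mul hc.ne' p2.ne']
  nlinarith

/-- The rectangle two-constants estimate. -/
theorem aux_rect (θ K N x0 : ℝ) (hθ : 0 < θ) (hN : 0 ≤ N) (hK : 0 ≤ K) (g : ℂ → ℂ)
    (hd : DifferentiableOn ℂ g {w : ℂ | |w.im| < θ})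
    (hc : ContinuousOn g {w : ℂ | |w.im| ≤ θ})
    (hb : ∀ w : ℂ, |w.im| ≤ θ → ‖g w‖ ≤ K)
    (htop : ∀ x : ℝ, x ≤ x0 + π / 2 → ‖g ⟨x, θ⟩‖ ≤ K * Real.exp (-N))
    (y : ℝ) (hy : |y| ≤ θ) :
    ‖g ⟨x0, y⟩‖ ≤ K * Real.exp (-(Real.sinh (y + θ) / Real.sinh (2 * θ) * N)) := by
  have hpi := Real.pi_pos
  have hS : 0 < Real.sinh (2 * θ) := Real.sinh_pos_iff.2 (by linarith)
  set H : ℂ → ℂ := fun w => (-Complex.I * (N / Real.sinh (2 * θ) : ℝ)) *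
    Complex.sin (w - x0 + θ * Complex.I) with hH
  have hHd : Differentiable ℂ H := by
    intro w; simp only [hH]; fun_prop
  have hre : ∀ w : ℂ, (H w).re =
      N / Real.sinh (2 * θ) * (Real.cos (w.re - x0) * Real.sinh (w.im + θ)) := by
    intro w
    have h1 : w - x0 + θ * Complex.I = ((w.re - x0 : ℝ) : ℂ) + ((w.im + θ : ℝ) : ℂ) * Complex.I := by
      apply Complex.ext <;> simp
    simp only [hH]
    rw [h1, Complex.sin_add_mul_I, ← Complex.ofReal_sin, ← Complex.ofReal_cos,
      ← Complex.ofReal_sinh, ← Complex.ofReal_cosh]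
    simp only [Complex.mul_re, Complex.mul_im, Complex.add_re, Complex.add_im, Complex.neg_re,
      Complex.neg_im, Complex.I_re, Complex.I_im, Complex.ofReal_re, Complex.ofReal_im]
    ring
  set U : Set ℂ := Ioo (x0 - π / 2) (x0 + π / 2) ×ℂ Ioo (-θ) θ with hU
  have hclU : closure U = Icc (x0 - π / 2) (x0 + π / 2) ×ℂ Icc (-θ) θ := by
    rw [hU, Complex.closure_reProdIm, closure_Ioo (by linarith), closure_Ioo (by linarith)]
  have hmax := Complex.norm_le_of_forall_mem_frontier_norm_le (U := U)
    (f := fun w => g w * Complex.exp (H w)) (C := K)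
    ((Metric.isBounded_Ioo _ _).reProdIm (Metric.isBounded_Ioo _ _))
    ⟨(hd.mono fun w hw => abs_lt.2 hw.2).mul hHd.cexp.differentiableOn, by
      rw [hclU]
      exact (hc.mono fun w hw => abs_le.2 hw.2).mul hHd.cexp.continuous.continuousOn⟩
    (by
      intro w hw
      rw [norm_mul, Complex.norm_exp, hre]
      rw [hU, Complex.frontier_reProdIm, closure_Ioo (by linarith), closure_Ioo (by linarith),
        frontier_Ioo (by linarith), frontier_Ioo (by linarith)] at hw
      rcases hw with ⟨h1, h2⟩ | ⟨h1, h2⟩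
      · rcases h2 with h2 | h2
        · have h2 : w.im = -θ := h2
          rw [h2]; simp
          exact hb w (by rw [h2, abs_neg, abs_of_pos hθ])
        · have h2 : w.im = θ := h2
          have hw' : w = ⟨w.re, θ⟩ := Complex.ext rfl h2
          have h3 := htop w.re h1.2
          rw [← hw'] at h3
          have h4 : N / Real.sinh (2 * θ) * (Real.cos (w.re - x0) * Real.sinh (w.im + θ)) ≤ N := by
            rw [h2, ← two_mul]
            have : N / Real.sinh (2 * θ) * (Real.cos (w.re - x0) * Real.sinh (2 * θ)) =
              N * Real.cos (w.re - x0) := by field_simp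
            rw [this]
            nlinarith [Real.cos_le_one (w.re - x0)]
          calc ‖g w‖ * Real.exp (N / Real.sinh (2 * θ) * (Real.cos (w.re - x0) * Real.sinh (w.im + θ)))
              ≤ (K * Real.exp (-N)) * Real.exp N := by gcongr
            _ = K := by rw [mul_assoc, ← Real.exp_add]; simp
      · have hcos : Real.cos (w.re - x0) = 0 := by
          rcases h1 with h1 | h1
          · have h1 : w.re = x0 - π / 2 := h1
            rw [h1, show x0 - π / 2 - x0 = -(π / 2) by ring, Real.cos_neg, Real.cos_pi_div_two]
          · have h1 : w.re = x0 + π / 2 := h1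
            rw [h1, show x0 + π / 2 - x0 = (π / 2) by ring, Real.cos_pi_div_two]
        rw [hcos]; simp
        exact hb w (abs_le.2 h2))
    (z := ⟨x0, y⟩) (by
      rw [hclU]
      exact ⟨⟨by simp; linarith, by simp; linarith⟩, abs_le.1 hy⟩)
  simp only [norm_mul, Complex.norm_exp, hre, sub_self, Real.cos_zero, one_mul] at hmax
  rw [Real.exp_neg, ← div_eq_mul_inv, le_div_iff₀ (Real.exp_pos _)]
  have heq : Real.sinh (y + θ) / Real.sinh (2 * θ) * N =
      N / Real.sinh (2 * θ) * Real.sinh (y + θ) := by ring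
  rw [heq]
  exact hmax

theorem aux_flat (M : ℕ → ℝ) (hM : GoodSeq M) (a C A x : ℝ) (ha : 0 ≤ a) (hC : 0 < C) (hA : 0 < A)
    (h : ∀ p : ℕ, a ≤ C * A ^ p * M p * Real.exp x ^ p) :
    a ≤ C * Real.exp (-assocM M (1 / (A * Real.exp x))) := by
  rcases ha.eq_or_lt with rfl | ha
  · positivity
  have hs : assocM M (1 / (A * Real.exp x)) ≤ Real.log (C / a) := by
    refine ciSup_le fun p => ?_
    have hp := hM.2.1 p
    refine Real.log_le_log (by positivity) ?_
    rw [div_le_div_iff₀ hp ha, one_div, inv_pow, mul_pow]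
    rw [inv_mul_le_iff₀ (by positivity)]
    calc a ≤ _ := h p
      _ = _ := by ring
  calc a = C * Real.exp (-Real.log (C / a)) := by
        rw [Real.exp_neg, Real.exp_log (by positivity)]; field_simp
    _ ≤ _ := by gcongr

/-- Lemma 3.3 of the paper: the flatness-extension lemma for arbitrary
opening `γ > 0`: if the bounded holomorphic `f` on `S_γ`, with continuous extension `g` to
the closed sector, is `M`-flat in direction `πγ/2`, then for each `0 < δ < πγ` one has an
`M`-exponential decay bound in the directions `[−πγ/2 + δ, πγ/2]`. -/
theorem mflat_extension_any_opening
    (M : ℕ → ℝ) (hM : GoodSeq M) (hPO : AdmitsNonzeroProximateOrder M)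
    (γ : ℝ) (hγ0 : 0 < γ) (f g : ℂ → ℂ)
    (hf : DifferentiableOn ℂ f (logSector 0 γ))
    (hbd : ∃ K : ℝ, ∀ w ∈ logSector 0 γ, ‖f w‖ ≤ K)
    (hg : ContinuousOn g {w : ℂ | |w.im| ≤ γ * π / 2})
    (hfg : ∀ w ∈ logSector 0 γ, g w = f w)
    (hflat : MFlatDir M g {w : ℂ | |w.im| ≤ γ * π / 2} (γ * π / 2)) :
    ∀ δ : ℝ, 0 < δ → δ < π * γ →
      ∃ k1 k2 : ℝ, 0 < k1 ∧ 0 < k2 ∧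
        ∀ w : ℂ, -(γ * π / 2) + δ ≤ w.im → w.im ≤ γ * π / 2 →
          ‖g w‖ ≤ k1 * Real.exp (-assocM M (1 / (k2 * Real.exp w.re))) := by
  intro δ hδ0 hδ
  obtain ⟨K0, hK0⟩ := hbd
  obtain ⟨r, C, A, hr, hC, hA, -, hfl⟩ := hflat
  set θ := γ * π / 2 with hθdef
  have hpi := Real.pi_pos
  have hθ : 0 < θ := by positivity
  have hδθ : δ < 2 * θ := by rw [hθdef]; linarith
  have hsec : logSector 0 γ = {w : ℂ | |w.im| < θ} := by
    ext w; simp [logSector, hθdef]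
  rw [hsec] at hf hK0 hfg
  have hgd : DifferentiableOn ℂ g {w : ℂ | |w.im| < θ} := hf.congr hfg
  have hgb : ∀ w : ℂ, |w.im| ≤ θ → ‖g w‖ ≤ K0 := by
    have hcl : closure {w : ℂ | |w.im| < θ} = {w : ℂ | |w.im| ≤ θ} := by
      have h1 : {w : ℂ | |w.im| < θ} = univ ×ℂ Ioo (-θ) θ := by
        ext w; simp [Complex.mem_reProdIm, abs_lt]
      have h2 : {w : ℂ | |w.im| ≤ θ} = univ ×ℂ Icc (-θ) θ := by
        ext w; simp [Complex.mem_reProdIm, abs_le]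
      rw [h1, h2, Complex.closure_reProdIm, closure_univ, closure_Ioo (by linarith)]
    intro w hw
    have h3 : g w ∈ closure (g '' {w : ℂ | |w.im| < θ}) := by
      apply ContinuousOn.image_closure (by rw [hcl]; exact hg)
      exact ⟨w, by rw [hcl]; exact hw, rfl⟩
    have h4 : closure (g '' {w : ℂ | |w.im| < θ}) ⊆ Metric.closedBall 0 K0 := by
      refine closure_minimal ?_ Metric.isClosed_closedBall
      rintro _ ⟨v, hv, rfl⟩
      rw [mem_closedBall_zero_iff, hfg v hv]
      exact hK0 v hv
    simpa using h4 h3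
  set K := max K0 C with hKdef
  have hKpos : 0 < K := hC.trans_le (le_max_right _ _)
  have hS : 0 < Real.sinh (2 * θ) := Real.sinh_pos_iff.2 (by linarith)
  set c := Real.sinh δ / Real.sinh (2 * θ) with hcdef
  have hc : 0 < c := div_pos (Real.sinh_pos_iff.2 hδ0) hS
  obtain ⟨lam, T, hlam, hT, habs⟩ := aux_absorb M hM hPO c hc
  have hlam0 : 0 < lam := by linarith
  set k2 := lam * A * Real.exp (π / 2) with hk2
  have hk2pos : 0 < k2 := by positivity
  set T' := max T (1 / (k2 * Real.exp (Real.log r - π / 2))) with hT'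
  refine ⟨K * Real.exp (assocM M T'), k2, by positivity, hk2pos, fun w hw1 hw2 => ?_⟩
  have hwim : |w.im| ≤ θ := abs_le.2 ⟨by linarith, hw2⟩
  set t := 1 / (k2 * Real.exp w.re) with ht
  have htpos : 0 < t := by positivity
  have hT'pos : 0 < T' := hT.trans_le (le_max_left _ _)
  by_cases hcase : t ≤ T'
  · calc ‖g w‖ ≤ K * 1 := by rw [mul_one]; exact (hgb w hwim).trans (le_max_left _ _)
      _ ≤ K * (Real.exp (assocM M T') * Real.exp (-assocM M t)) := by
        rw [← Real.exp_add]
        gcongr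
        exact Real.one_le_exp (by linarith [aux_monoM M hM t T' htpos hcase])
      _ = _ := by ring
  · push Not at hcase
    have htT : T ≤ t := (le_max_left _ _).trans hcase.le
    have hxr : w.re + π / 2 ≤ Real.log r := by
      have h1 : 1 / (k2 * Real.exp (Real.log r - π / 2)) < t := (le_max_right _ _).trans_lt hcase
      rw [ht, one_div_lt_one_div (by positivity) (by positivity)] at h1
      have h2 := Real.exp_lt_exp.1 (lt_of_mul_lt_mul_left h1 hk2pos.le)
      linarith
    have hτ : 1 / (A * Real.exp (w.re + π / 2)) = lam * t := by
      rw [ht, hk2, Real.exp_add]; field_simp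
    have hN : 0 ≤ assocM M (lam * t) := aux_nonneg M hM _ (by positivity)
    have hR := aux_rect θ K (assocM M (lam * t)) w.re hθ hN hKpos.le g hgd hg
      (fun v hv => (hgb v hv).trans (le_max_left _ _))
      (fun x hx => by
        have h1 := aux_flat M hM _ C A x (norm_nonneg _) hC hA (hfl x (hx.trans hxr))
        have h2 : assocM M (lam * t) ≤ assocM M (1 / (A * Real.exp x)) := by
          rw [← hτ]
          exact aux_monoM M hM _ _ (by positivity) (by gcongr)
        calc _ ≤ _ := h1
          _ ≤ _ := by
            gcongr
            exact le_max_right _ _) w.im hwim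
    have hcle : c ≤ Real.sinh (w.im + θ) / Real.sinh (2 * θ) := by
      rw [hcdef]
      gcongr
      exact Real.sinh_le_sinh.2 (by linarith)
    have h5 := habs t htT
    have h6 : c * assocM M (lam * t) ≤
      Real.sinh (w.im + θ) / Real.sinh (2 * θ) * assocM M (lam * t) := by gcongr
    calc ‖g w‖ ≤ _ := hR
      _ ≤ K * Real.exp (-assocM M t) := by
        gcongr
        linarith
      _ ≤ K * Real.exp (assocM M T') * Real.exp (-assocM M t) := by
        gcongr
        exact le_mul_of_one_le_right hKpos.le
          (Real.one_le_exp (aux_nonneg M hM _ hT'pos))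
end
end

section
/- Let M = (M_p) be a logarithmically convex sequence of positive reals with M_0 = 1, whose quotients m_p := M_{p+1}/M_p tend to infinity, and which admits a nonzero proximate order, and let γ > 0. Suppose f is holomorphic in a sectorial region G_γ, bounded in every proper bounded subsector T ≪ G_γ, and M-flat in some direction θ in G_γ. Then for every proper bounded subsector T ≪ G_γ there exist constants k1(T), k2(T) > 0 such that |f(z)| ≤ k1·e^{−M(1/(k2·|z|))} for every z ∈ T. -/
open Filter Topology Set
open scoped Real

noncomputable section

lemma mono_off_locally_finite (H H' : ℝ → ℝ) (E : Set ℝ) (a : ℝ)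
    (hE : ∀ R : ℝ, (E ∩ Iic R).Finite) (hc : ContinuousOn H (Ici a))
    (hd : ∀ x, a < x → x ∉ E → HasDerivAt H (H' x) x)
    (hn : ∀ x, a < x → x ∉ E → 0 ≤ H' x) :
    ∀ n : ℕ, ∀ s t : ℝ, a ≤ s → s ≤ t → (E ∩ Ioo s t).ncard ≤ n → H s ≤ H t := by
  have hfin : ∀ s t : ℝ, (E ∩ Ioo s t).Finite := fun s t =>
    (hE t).subset (fun x hx => ⟨hx.1, hx.2.2.le⟩)
  intro n
  induction n with
  | zero =>
    intro s t has hst hcard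
    have hemp : E ∩ Ioo s t = ∅ := by
      rw [← Set.ncard_eq_zero (hfin s t)]; omega
    have hnot : ∀ x ∈ Ioo s t, x ∉ E := fun x hx hxE => by
      have : x ∈ E ∩ Ioo s t := ⟨hxE, hx⟩
      rw [hemp] at this; exact this
    have hmono : MonotoneOn H (Icc s t) := by
      refine monotoneOn_of_deriv_nonneg (convex_Icc s t)
        (hc.mono fun x hx => le_trans has hx.1) ?_ ?_
      · rw [interior_Icc]
        intro x hx
        exact (hd x (lt_of_le_of_lt has hx.1) (hnot x hx)).differentiableAt.differentiableWithinAt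
      · rw [interior_Icc]
        intro x hx
        rw [(hd x (lt_of_le_of_lt has hx.1) (hnot x hx)).deriv]
        exact hn x (lt_of_le_of_lt has hx.1) (hnot x hx)
    exact hmono (left_mem_Icc.2 hst) (right_mem_Icc.2 hst) hst
  | succ n ih =>
    intro s t has hst hcard
    rcases (E ∩ Ioo s t).eq_empty_or_nonempty with h | ⟨e, heE, he⟩
    · exact ih s t has hst (by rw [h]; simp)
    · have key : ∀ s' t', Ioo s' t' ⊆ Ioo s t → e ∉ Ioo s' t' →
          (E ∩ Ioo s' t').ncard ≤ n := by
        intro s' t' hsub hne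
        have : (E ∩ Ioo s' t').ncard < (E ∩ Ioo s t).ncard := by
          apply Set.ncard_lt_ncard _ (hfin s t)
          refine ⟨fun x hx => ⟨hx.1, hsub hx.2⟩, fun h => hne (h ⟨heE, he⟩).2⟩
        omega
      exact (ih s e has he.1.le (key _ _ (Ioo_subset_Ioo_right he.2.le) (by simp))).trans
        (ih e t (has.trans he.1.le) he.2.le (key _ _ (Ioo_subset_Ioo_left he.1.le) (by simp)))

/-- `V(t) = t^{ρ(t)}` grows at least like `t^{ℓ/2}` locally. -/
lemma proximate_growth {c : ℝ} {ρ : ℝ → ℝ} {l : ℝ} (hl : 0 < l) (h : IsProximateOrder c ρ l) :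
    ∃ t0 : ℝ, 1 ≤ t0 ∧ ∀ s t, t0 ≤ s → s ≤ t →
      ρ s * Real.log s - l / 2 * Real.log s ≤ ρ t * Real.log t - l / 2 * Real.log t := by
  obtain ⟨hc, -, hlim, E, ρ', hE, hd, -, -, hlim'⟩ := h
  have h1 : ∀ᶠ t in atTop, 3 * l / 4 < ρ t := hlim.eventually_const_lt (by linarith)
  have h2 : ∀ᶠ t in atTop ⊓ 𝓟 (Ioi c \ E), -(l / 4) < t * ρ' t * Real.log t :=
    hlim'.eventually_const_lt (by linarith)
  rw [eventually_inf_principal] at h2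
  obtain ⟨a, ha⟩ := eventually_atTop.1 (h1.and h2)
  set t0 := max (max a (c + 1)) 1 with ht0
  have hat : a ≤ t0 := (le_max_left _ _).trans (le_max_left _ _)
  have hct : c < t0 := lt_of_lt_of_le (by linarith : c < c + 1)
    ((le_max_right _ _).trans (le_max_left _ _))
  have h1t : 1 ≤ t0 := le_max_right _ _
  refine ⟨t0, h1t, fun s t hs hst => ?_⟩
  refine mono_off_locally_finite (fun t => ρ t * Real.log t - l / 2 * Real.log t)
    (fun t => ρ' t * Real.log t + ρ t * t⁻¹ - l / 2 * t⁻¹) E t0 hE ?_ ?_ ?_ _ s t hs hst le_rfl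
  · have hlog : ContinuousOn Real.log (Ici t0) := fun x hx =>
      (Real.continuousAt_log (by have : t0 ≤ x := hx; linarith)).continuousWithinAt
    exact ((hc.mono fun x hx => lt_of_lt_of_le hct hx).mul hlog).sub
      (continuousOn_const.mul hlog)
  · intro x hx hxE
    have hl := Real.hasDerivAt_log (by linarith : x ≠ 0)
    exact ((hd x ⟨hct.trans hx, hxE⟩).mul hl).sub (hl.const_mul _)
  · intro x hx hxE
    obtain ⟨hr, hr'⟩ := ha x (hat.trans hx.le)
    have hr' := hr' ⟨hct.trans hx, hxE⟩
    have hx0 : 0 < x := by linarith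
    have : ρ' x * Real.log x + ρ x * x⁻¹ - l / 2 * x⁻¹
        = x⁻¹ * (x * ρ' x * Real.log x + ρ x - l / 2) := by
      field_simp
    rw [this]
    exact mul_nonneg (by positivity) (by linarith)

lemma assoc_bdd {M : ℕ → ℝ} (hM : GoodSeq M) {t : ℝ} (ht : 0 < t) :
    BddAbove (range fun p : ℕ => Real.log (t ^ p / M p)) := by
  obtain ⟨-, hpos, -, hlim⟩ := hM
  obtain ⟨N, hN⟩ := eventually_atTop.1 (hlim.eventually_ge_atTop t)
  have hstep : ∀ p, N ≤ p → Real.log (t ^ p / M p) ≤ Real.log (t ^ N / M N) := by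
    intro p hp
    induction p, hp using Nat.le_induction with
    | base => exact le_rfl
    | succ p hp ih =>
      refine le_trans (Real.log_le_log (div_pos (pow_pos ht _) (hpos _)) ?_) ih
      have h := hN p hp
      rw [le_div_iff₀ (hpos p)] at h
      rw [div_le_div_iff₀ (hpos _) (hpos _), pow_succ]
      have := mul_le_mul_of_nonneg_left h (pow_pos ht p).le
      linarith
  have : (Set.range fun p : ℕ => Real.log (t ^ p / M p)) ⊆
      (fun p : ℕ => Real.log (t ^ p / M p)) '' (Iic N) ∪ Iic (Real.log (t ^ N / M N)) := by
    rintro _ ⟨p, rfl⟩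
    rcases le_total p N with h | h
    · exact Or.inl ⟨p, h, rfl⟩
    · exact Or.inr (hstep p h)
  exact (((Set.finite_Iic N).image _).bddAbove.union bddAbove_Iic).mono this

lemma assoc_nonneg {M : ℕ → ℝ} (hM : GoodSeq M) {t : ℝ} (ht : 0 < t) : 0 ≤ assocM M t := by
  refine le_trans (le_of_eq ?_) (le_ciSup (assoc_bdd hM ht) 0)
  simp [hM.1]

lemma assoc_mono {M : ℕ → ℝ} (hM : GoodSeq M) {s t : ℝ} (hs : 0 < s) (hst : s ≤ t) :
    assocM M s ≤ assocM M t := by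
  apply ciSup_mono (assoc_bdd hM (hs.trans_le hst))
  intro p
  have := hM.2.1 p
  exact Real.log_le_log (by positivity) (by gcongr)

lemma assoc_pos {M : ℕ → ℝ} (hM : GoodSeq M) {t : ℝ} (ht : M 1 < t) : 0 < assocM M t := by
  have h1 := hM.2.1 1
  have := le_ciSup (assoc_bdd hM (h1.trans ht)) 1
  refine lt_of_lt_of_le (Real.log_pos ?_) this
  rw [pow_one]
  exact (one_lt_div h1).2 ht

lemma flat_to_exp {M : ℕ → ℝ} (hM : GoodSeq M) {t C v : ℝ} (ht : 0 < t) (hC : 0 < C)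
    (h : ∀ p : ℕ, v ≤ C * (M p / t ^ p)) : v ≤ C * Real.exp (-assocM M t) := by
  rcases le_or_gt v 0 with hv | hv
  · exact hv.trans (by positivity)
  have : assocM M t ≤ Real.log (C / v) := by
    apply ciSup_le
    intro p
    have hp := hM.2.1 p
    have htp := pow_pos ht p
    apply Real.log_le_log (by positivity)
    have := h p
    rw [div_le_div_iff₀ hp hv]
    rw [← mul_div_assoc, le_div_iff₀ htp] at this
    linarith
  calc v = C * Real.exp (-Real.log (C / v)) := by
        rw [Real.exp_neg, Real.exp_log (by positivity)]; field_simp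
    _ ≤ _ := by gcongr

lemma assoc_growth {M : ℕ → ℝ} (hM : GoodSeq M) (hPO : AdmitsNonzeroProximateOrder M)
    {δ : ℝ} (hδ : 0 < δ) :
    ∃ k C : ℝ, 0 < k ∧ ∀ t, 0 < t → assocM M (t / k) ≤ δ * assocM M t + C := by
  obtain ⟨c, l, ρ, hl, hρ, A, B, hAB⟩ := hPO
  obtain ⟨t0, h1, hgr⟩ := proximate_growth hl hρ
  obtain ⟨t1, hAB⟩ := eventually_atTop.1 hAB
  set k := Real.exp (2 * |B - A - Real.log δ| / l) with hk
  have hk0 : 0 < k := Real.exp_pos _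
  have hk1 : 1 ≤ k := Real.one_le_exp (by positivity)
  set S := max (max t0 t1) (max 2 (M 1 + 1)) with hS
  have S0 : t0 ≤ S := (le_max_left _ _).trans (le_max_left _ _)
  have S1 : t1 ≤ S := (le_max_right _ _).trans (le_max_left _ _)
  have S2 : 2 ≤ S := (le_max_left _ _).trans (le_max_right _ _)
  have S3 : M 1 + 1 ≤ S := (le_max_right _ _).trans (le_max_right _ _)
  have hb : ∀ t, S ≤ t → A ≤ ρ t * Real.log t - Real.log (assocM M t) ∧
      ρ t * Real.log t - Real.log (assocM M t) ≤ B := by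
    intro t ht
    have hlog : Real.log t ≠ 0 := (Real.log_pos (by linarith)).ne'
    have := hAB t (S1.trans ht)
    have e : Real.log t * (ρ t - Real.log (assocM M t) / Real.log t)
      = ρ t * Real.log t - Real.log (assocM M t) := by field_simp
    rwa [e] at this
  refine ⟨k, assocM M S, hk0, fun t ht => ?_⟩
  rcases le_total (t / k) S with h | h
  · have := assoc_mono hM (div_pos ht hk0) h
    have := mul_nonneg hδ.le (assoc_nonneg hM ht)
    linarith
  · have hle : t / k ≤ t := div_le_self ht.le hk1
    have hs := hb _ h
    have htt := hb _ (h.trans hle)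
    have hg := hgr _ _ (S0.trans h) hle
    have hlog : Real.log (t / k) = Real.log t - Real.log k := Real.log_div ht.ne' hk0.ne'
    have hlk : l / 2 * Real.log k = |B - A - Real.log δ| := by
      rw [hk, Real.log_exp]; field_simp
    have hab := le_abs_self (B - A - Real.log δ)
    have p1 : 0 < assocM M (t / k) := assoc_pos hM (by linarith)
    have p2 : 0 < assocM M t := assoc_pos hM (by linarith)
    have : Real.log (assocM M (t / k)) ≤ Real.log (δ * assocM M t) := by
      rw [Real.log_mul hδ.ne' p2.ne']
      have : l / 2 * Real.log (t / k) = l / 2 * Real.log t - |B - A - Real.log δ| := by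
        rw [hlog, mul_sub, hlk]
      linarith [hs.1, htt.2]
    have := (Real.log_le_log_iff p1 (by positivity)).1 this
    have := assoc_nonneg hM (by linarith : 0 < S)
    linarith

/-- Two constants theorem on a rectangle with explicit harmonic majorant. -/
lemma two_constants (f : ℂ → ℂ) (x0 y0 b K N : ℝ) (hb : 0 < b) (hK : 0 ≤ K) (hN : 0 ≤ N)
    (hd : ∀ w : ℂ, |w.re - x0| ≤ π / 2 → y0 ≤ w.im → w.im ≤ y0 + b → DifferentiableAt ℂ f w)
    (hB : ∀ w : ℂ, |w.re - x0| ≤ π / 2 → y0 ≤ w.im → w.im ≤ y0 + b → ‖f w‖ ≤ K)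
    (hbot : ∀ w : ℂ, |w.re - x0| ≤ π / 2 → w.im = y0 → ‖f w‖ ≤ K * Real.exp (-N))
    (y : ℝ) (hy0 : y0 ≤ y) (hyb : y ≤ y0 + b) :
    ‖f ⟨x0, y⟩‖ ≤ K * Real.exp (-(N * (Real.sinh (y0 + b - y) / Real.sinh b))) := by
  have hpi := Real.pi_pos
  have hsb : 0 < Real.sinh b := Real.sinh_pos_iff.2 hb
  set g : ℂ → ℂ := fun w =>
    ((N / Real.sinh b : ℝ) : ℂ) * Complex.sinh (b + Complex.I * (w - ⟨x0, y0⟩)) with hg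
  have hgre : ∀ w : ℂ, (g w).re =
      N / Real.sinh b * (Real.sinh (y0 + b - w.im) * Real.cos (w.re - x0)) := by
    intro w
    have e : (b + Complex.I * (w - ⟨x0, y0⟩) : ℂ)
        = ((y0 + b - w.im : ℝ) : ℂ) + ((w.re - x0 : ℝ) : ℂ) * Complex.I := by
      apply Complex.ext <;> simp <;> ring
    simp only [hg]
    rw [e, Complex.re_ofReal_mul, Complex.sinh_add, Complex.cosh_mul_I, Complex.sinh_mul_I,
      ← Complex.ofReal_sinh, ← Complex.ofReal_cosh, ← Complex.ofReal_cos, ← Complex.ofReal_sin]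
    simp only [Complex.add_re, Complex.mul_re, Complex.mul_im, Complex.ofReal_re,
      Complex.ofReal_im, Complex.I_re, Complex.I_im]
    ring
  have hgd : Differentiable ℂ g := by
    intro w
    simp only [hg]
    fun_prop
  set F : ℂ → ℂ := fun w => f w * Complex.exp (g w) with hF
  set U : Set ℂ := Ioo (x0 - π / 2) (x0 + π / 2) ×ℂ Ioo y0 (y0 + b) with hU
  have hcl : closure U = Icc (x0 - π / 2) (x0 + π / 2) ×ℂ Icc y0 (y0 + b) := by
    rw [hU, Complex.closure_reProdIm, closure_Ioo (by linarith), closure_Ioo (by linarith)]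
  have hmem : ∀ w ∈ closure U, |w.re - x0| ≤ π / 2 ∧ y0 ≤ w.im ∧ w.im ≤ y0 + b := by
    intro w hw
    rw [hcl, Complex.mem_reProdIm] at hw
    exact ⟨abs_le.2 ⟨by linarith [hw.1.1], by linarith [hw.1.2]⟩, hw.2.1, hw.2.2⟩
  have hUo : IsOpen U := isOpen_Ioo.reProdIm isOpen_Ioo
  have hUb : Bornology.IsBounded U :=
    (Metric.isBounded_Ioo _ _).reProdIm (Metric.isBounded_Ioo _ _)
  have hFd : DiffContOnCl ℂ F U := by
    apply DifferentiableOn.diffContOnCl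
    intro w hw
    obtain ⟨h1, h2, h3⟩ := hmem w hw
    exact ((hd w h1 h2 h3).mul (hgd w).cexp).differentiableWithinAt
  have hFn : ∀ w, ‖F w‖ = ‖f w‖ * Real.exp (g w).re := by
    intro w; simp [hF, Complex.norm_exp]
  have hfr : ∀ w ∈ frontier U, ‖F w‖ ≤ K := by
    intro w hw
    rw [hUo.frontier_eq] at hw
    obtain ⟨h1, h2, h3⟩ := hmem w hw.1
    rw [hFn, hgre]
    have hz : ∀ {u : ℝ}, u = 0 → ‖f w‖ * Real.exp (N / Real.sinh b * u) ≤ K := by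
      rintro u rfl
      simpa using hB w h1 h2 h3
    by_cases hy : w.im = y0
    · have hf := hbot w h1 hy
      have hu : N / Real.sinh b * (Real.sinh (y0 + b - w.im) * Real.cos (w.re - x0)) ≤ N := by
        have e : y0 + b - w.im = b := by rw [hy]; ring
        rw [e, ← mul_assoc, div_mul_cancel₀ _ hsb.ne']
        exact mul_le_of_le_one_right hN (Real.cos_le_one _)
      calc _ ≤ K * Real.exp (-N) * Real.exp N := by gcongr
        _ = K := by rw [mul_assoc, ← Real.exp_add]; simp
    · by_cases hyt : w.im = y0 + b
      · apply hz; rw [hyt]; simp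
      · apply hz
        have : Real.cos (w.re - x0) = 0 := by
          have h4 : |w.re - x0| = π / 2 := by
            by_contra hne
            apply hw.2
            have := abs_lt.1 (lt_of_le_of_ne h1 hne)
            rw [hU, Complex.mem_reProdIm]
            exact ⟨⟨by linarith [this.1], by linarith [this.2]⟩,
              lt_of_le_of_ne h2 (Ne.symm hy), lt_of_le_of_ne h3 hyt⟩
          rw [← Real.cos_abs, h4, Real.cos_pi_div_two]
        rw [this, mul_zero]
  have hin : (⟨x0, y⟩ : ℂ) ∈ closure U := by
    rw [hcl, Complex.mem_reProdIm]
    exact ⟨⟨by simp; linarith, by simp; linarith⟩, hy0, hyb⟩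
  have := Complex.norm_le_of_forall_mem_frontier_norm_le hUb hFd hfr hin
  rw [hFn, hgre] at this
  simp only [sub_self, Real.cos_zero, mul_one] at this
  have e : N / Real.sinh b * Real.sinh (y0 + b - y)
    = N * (Real.sinh (y0 + b - y) / Real.sinh b) := by ring
  rw [e] at this
  rw [Real.exp_neg, ← div_eq_mul_inv, le_div_iff₀ (Real.exp_pos _)]
  exact this

/-- Consequence with a symmetric strip. -/
lemma strip_bound (f : ℂ → ℂ) (x0 θ y1 Y K N : ℝ) (hy1 : y1 < Y) (hθ : |θ| ≤ y1)
    (hK : 0 ≤ K) (hN : 0 ≤ N)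
    (hd : ∀ w : ℂ, |w.re - x0| ≤ π / 2 → |w.im| ≤ Y → DifferentiableAt ℂ f w)
    (hB : ∀ w : ℂ, |w.re - x0| ≤ π / 2 → |w.im| ≤ Y → ‖f w‖ ≤ K)
    (hbot : ∀ w : ℂ, |w.re - x0| ≤ π / 2 → w.im = θ → ‖f w‖ ≤ K * Real.exp (-N))
    (y : ℝ) (hy : |y| ≤ y1) :
    ‖f ⟨x0, y⟩‖ ≤ K * Real.exp (-(N * (Real.sinh (Y - y1) / Real.sinh (2 * Y)))) := by
  -- reduce to the case `θ ≤ y`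
  wlog hle : θ ≤ y generalizing f x0 θ y
  · have := this (fun w => f (-w)) (-x0) (-θ) (by rwa [abs_neg]) ?_ ?_ ?_ (-y)
      (by rwa [abs_neg]) (by linarith)
    · have e : -(⟨-x0, -y⟩ : ℂ) = ⟨x0, y⟩ := by apply Complex.ext <;> simp
      simpa only [e] using this
    · intro w h1 h2
      have : DifferentiableAt ℂ f (-w) := by
        apply hd
        · rw [Complex.neg_re, ← abs_neg]; convert h1 using 2; ring
        · rwa [Complex.neg_im, abs_neg]
      exact this.comp w differentiableAt_id.neg
    · intro w h1 h2
      apply hB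
      · rw [Complex.neg_re, ← abs_neg]; convert h1 using 2; ring
      · rwa [Complex.neg_im, abs_neg]
    · intro w h1 h2
      apply hbot
      · rw [Complex.neg_re, ← abs_neg]; convert h1 using 2; ring
      · rw [Complex.neg_im, h2, neg_neg]
  have hθ' := abs_le.1 hθ
  have hy' := abs_le.1 hy
  have hbpos : 0 < Y - θ := by linarith [hθ'.2]
  have hbnd : ∀ w : ℂ, θ ≤ w.im → w.im ≤ θ + (Y - θ) → |w.im| ≤ Y := fun w h1 h2 =>
    abs_le.2 ⟨by linarith [hθ'.1], by linarith⟩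
  refine (two_constants f x0 θ (Y - θ) K N hbpos hK hN
    (fun w h1 h2 h3 => hd w h1 (hbnd w h2 h3)) (fun w h1 h2 h3 => hB w h1 (hbnd w h2 h3))
    hbot y hle (by linarith [hy'.2])).trans ?_
  have hs1 : 0 < Real.sinh (Y - θ) := Real.sinh_pos_iff.2 hbpos
  have hs2 : Real.sinh (Y - θ) ≤ Real.sinh (2 * Y) := Real.sinh_le_sinh.2 (by linarith [hθ'.1])
  have hs3 : Real.sinh (Y - y1) ≤ Real.sinh (θ + (Y - θ) - y) :=
    Real.sinh_le_sinh.2 (by linarith [hy'.2])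
  have hs4 : 0 < Real.sinh (Y - y1) := Real.sinh_pos_iff.2 (by linarith)
  gcongr
  exact hs4.le.trans hs3

/-- Proposition 3.7 of the paper: if `f` is holomorphic in a sectorial
region `G_γ`, bounded in every proper bounded subsector `T ≪ G_γ`, and `M`-flat in some
direction `θ` of `G_γ`, then on every proper bounded subsector `T ≪ G_γ` it satisfies an
`M`-exponential decay bound. -/
theorem mflat_extension_sectorial_region
    (M : ℕ → ℝ) (hM : GoodSeq M) (hPO : AdmitsNonzeroProximateOrder M)
    (γ : ℝ) (hγ0 : 0 < γ) (G : Set ℂ) (hG : SectorialRegion 0 γ G)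
    (f : ℂ → ℂ) (hf : DifferentiableOn ℂ f G)
    (hbd : ∀ d β r : ℝ, ProperSubsector G d β r →
      ∃ K : ℝ, ∀ w ∈ logSectorB d β r, ‖f w‖ ≤ K)
    (θ : ℝ) (hθ : |θ| < γ * π / 2) (hflat : MFlatDir M f G θ) :
    ∀ d β r : ℝ, ProperSubsector G d β r →
      ∃ k1 k2 : ℝ, 0 < k1 ∧ 0 < k2 ∧
        ∀ w ∈ logSectorB d β r,
          ‖f w‖ ≤ k1 * Real.exp (-assocM M (1 / (k2 * Real.exp w.re))) := by
  intro d β r hT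
  have hpi := Real.pi_pos
  obtain ⟨hGo, -, hGsub, hGsec⟩ := hG
  obtain ⟨rf, C, A, hrf, hC, hA, hfD, hfl⟩ := hflat
  obtain ⟨hβ, hr, hTG⟩ := hT
  -- the closed sector is strictly inside the strip
  have hsup : d + β * π / 2 < γ * π / 2 := by
    have : (⟨Real.log r, d + β * π / 2⟩ : ℂ) ∈ logSectorC d β r :=
      ⟨by simp [abs_of_pos (by positivity : 0 < β * π / 2)], le_rfl⟩
    have h := hGsub (hTG this)
    simp only [logSector, Set.mem_ofPred_eq, sub_zero] at h
    exact (abs_lt.1 h).2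
  have hinf : -(γ * π / 2) < d - β * π / 2 := by
    have : (⟨Real.log r, d - β * π / 2⟩ : ℂ) ∈ logSectorC d β r :=
      ⟨by simp [abs_of_pos (by positivity : 0 < β * π / 2)], le_rfl⟩
    have h := hGsub (hTG this)
    simp only [logSector, Set.mem_ofPred_eq, sub_zero] at h
    exact (abs_lt.1 h).1
  obtain ⟨y1, hy1, hy1γ⟩ : ∃ y1, max |θ| (max (d + β * π / 2) (-(d - β * π / 2))) < y1 ∧
      y1 < γ * π / 2 := exists_between (max_lt hθ (max_lt hsup (by linarith)))
  have hθy : |θ| < y1 := (le_max_left _ _).trans_lt hy1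
  have hTy : ∀ w ∈ logSectorB d β r, |w.im| ≤ y1 := by
    intro w hw
    have h1 := abs_lt.1 hw.1
    have h2 := (le_max_right _ _).trans_lt hy1
    have h3 := (le_max_left _ _).trans_lt h2
    have h4 := (le_max_right _ _).trans_lt h2
    exact abs_le.2 ⟨by linarith [h1.1], by linarith [h1.2]⟩
  obtain ⟨Y, hyY, hYγ⟩ := exists_between hy1γ
  obtain ⟨Y', hYY', hY'γ⟩ := exists_between hYγ
  obtain ⟨Y'', hYY'', hY''γ⟩ := exists_between hY'γ
  have hy10 : 0 < y1 := (abs_nonneg θ).trans_lt hθy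
  have hconv : ∀ Z : ℝ, (2 * Z / π) * π / 2 = Z := fun Z => by field_simp
  obtain ⟨R, hR, hRG⟩ := hGsec (2 * Y'' / π) (div_pos (by linarith) hpi)
    (by rw [div_lt_iff₀ hpi]; linarith)
  have hlogR : Real.log (R / 2) < Real.log R := Real.log_lt_log (by linarith) (by linarith)
  have hP : ProperSubsector G 0 (2 * Y' / π) (R / 2) := by
    refine ⟨div_pos (by linarith) hpi, by linarith, fun w hw => hRG ?_⟩
    obtain ⟨h1, h2⟩ := hw
    rw [hconv] at h1
    refine ⟨?_, by linarith⟩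
    rw [hconv]; linarith
  have hinG : ∀ w : ℂ, |w.im| ≤ Y → w.re ≤ Real.log (R / 2) → w ∈ G := fun w h1 h2 =>
    hP.2.2 ⟨by rw [hconv, sub_zero]; linarith, h2⟩
  obtain ⟨K0, hK0⟩ := hbd _ _ _ hP
  obtain ⟨KT, hKT⟩ := hbd d β r ⟨hβ, hr, hTG⟩
  set K := max K0 C with hKdef
  have hKpos : 0 < K := hC.trans_le (le_max_right _ _)
  set X := min (Real.log rf) (Real.log (R / 2)) - π / 2 - 1 with hX
  have hX1 : X + π / 2 + 1 ≤ Real.log rf := by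
    have := min_le_left (Real.log rf) (Real.log (R / 2)); linarith
  have hX2 : X + π / 2 + 1 ≤ Real.log (R / 2) := by
    have := min_le_right (Real.log rf) (Real.log (R / 2)); linarith
  set δ := Real.sinh (Y - y1) / Real.sinh (2 * Y) with hδ
  have hδ0 : 0 < δ :=
    div_pos (Real.sinh_pos_iff.2 (by linarith)) (Real.sinh_pos_iff.2 (by linarith))
  obtain ⟨k, C', hk, hgrow⟩ := assoc_growth hM hPO hδ0
  set k2 := k * (A * Real.exp (π / 2)) with hk2
  have hk20 : 0 < k2 := by positivity
  set k1 := max (K * Real.exp C') (|KT| * Real.exp (assocM M (1 / (k2 * Real.exp X)))) with hk1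
  have hk10 : 0 < k1 := lt_of_lt_of_le (by positivity) (le_max_left _ _)
  refine ⟨k1, k2, hk10, hk20, fun w hw => ?_⟩
  rcases le_total w.re X with hwX | hwX
  · set t := 1 / (A * Real.exp (w.re + π / 2)) with ht
    have ht0 : 0 < t := by positivity
    have hmain := strip_bound f w.re θ y1 Y K (assocM M t) hyY hθy.le hKpos.le
      (assoc_nonneg hM ht0) ?_ ?_ ?_ w.im (hTy w hw)
    · refine hmain.trans ?_
      have hg := hgrow t ht0
      have e : t / k = 1 / (k2 * Real.exp w.re) := by
        rw [ht, hk2, Real.exp_add]; field_simp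
      rw [e] at hg
      calc _ ≤ K * Real.exp (C' + -assocM M (1 / (k2 * Real.exp w.re))) := by
            apply mul_le_mul_of_nonneg_left _ hKpos.le
            apply Real.exp_le_exp.2
            rw [← hδ, mul_comm]
            linarith
        _ = K * Real.exp C' * Real.exp (-assocM M (1 / (k2 * Real.exp w.re))) := by
            rw [Real.exp_add]; ring
        _ ≤ _ := by gcongr; exact le_max_left _ _
    · intro v h1 h2
      have := (abs_le.1 h1).2
      exact hf.differentiableAt (hGo.mem_nhds (hinG v h2 (by linarith)))
    · intro v h1 h2
      have := (abs_le.1 h1).2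
      refine (hK0 v ⟨?_, by linarith⟩).trans (le_max_left _ _)
      rw [hconv, sub_zero]; linarith
    · intro v h1 h2
      have hre := (abs_le.1 h1).2
      have hv : v = ⟨v.re, θ⟩ := by apply Complex.ext <;> simp [h2]
      have hfv := hfl v.re (by linarith)
      rw [← hv] at hfv
      have h3 : ‖f v‖ ≤ C * Real.exp (-assocM M (1 / (A * Real.exp v.re))) := by
        apply flat_to_exp hM (by positivity) hC
        intro p
        refine (hfv p).trans (le_of_eq ?_)
        rw [div_pow, one_pow, mul_pow]
        field_simp
      refine h3.trans ?_
      have hmono : assocM M t ≤ assocM M (1 / (A * Real.exp v.re)) := by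
        apply assoc_mono hM ht0
        rw [ht]
        gcongr
        linarith
      gcongr
      exact le_max_right _ _
  · have hmono : assocM M (1 / (k2 * Real.exp w.re)) ≤ assocM M (1 / (k2 * Real.exp X)) := by
      apply assoc_mono hM (by positivity)
      gcongr
    calc ‖f w‖ ≤ |KT| := (hKT w hw).trans (le_abs_self _)
      _ = |KT| * Real.exp (assocM M (1 / (k2 * Real.exp X))) *
          Real.exp (-assocM M (1 / (k2 * Real.exp X))) := by
          rw [mul_assoc, ← Real.exp_add]; simp
      _ ≤ k1 * Real.exp (-assocM M (1 / (k2 * Real.exp w.re))) := by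
          gcongr
          exact le_max_right _ _
end
end
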